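/- arXiv:2104.02038 — 3 statements merged into one kernel-verified Lean document; each statement's English description precedes it below -/
import Mathlib

section
/- Suppose A is a nontrivial unital complex Banach algebra and λ ∈ ℂ with λ ≠ 0. Then there are no elements a, b ∈ A such that ab - ba = λ·1. -/
theorem pow_succ_mul_sub_mul_pow_succ {R A : Type*} [CommRing R] [Ring A] [Algebra R A]
    {a b : A} {r : R} (h : a * b - b * a = r • (1 : A)) (n : ℕ) :
    a ^ (n + 1) * b - b * a ^ (n + 1) = (((n + 1 : ℕ) : R) * r) • a ^ n := by
  induction n with
  | zero => simpa using h
  | succ n ih =>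
    calc a ^ (n + 1 + 1) * b - b * a ^ (n + 1 + 1)
        = a * (a ^ (n + 1) * b - b * a ^ (n + 1)) + (a * b - b * a) * a ^ (n + 1) := by
          rw [pow_succ' a (n + 1)]; noncomm_ring
      _ = (((n + 1 + 1 : ℕ) : R) * r) • a ^ (n + 1) := by
          rw [ih, h, mul_smul_comm, ← pow_succ', smul_mul_assoc, one_mul, ← add_smul]
          congr 1
          push_cast
          ring

/-- In a nontrivial unital complex Banach algebra, there are no elements `a, b` with
`ab - ba = λ·1` for a nonzero scalar `λ`. -/
theorem stmt_8 {A : Type*} [NormedRing A] [NormedAlgebra ℂ A] [CompleteSpace A]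
    [NormOneClass A] [Nontrivial A] (lam : ℂ) (hlam : lam ≠ 0) :
    ¬ ∃ a b : A, a * b - b * a = lam • (1 : A) := by
  rintro ⟨a, b, h⟩
  have key := pow_succ_mul_sub_mul_pow_succ h
  have hne (n : ℕ) : a ^ n ≠ 0 := by
    induction n with
    | zero => simp
    | succ n ih =>
      intro h0
      have hn := key n
      rw [h0, zero_mul, mul_zero, sub_zero] at hn
      exact smul_ne_zero (mul_ne_zero (Nat.cast_ne_zero.mpr n.succ_ne_zero) hlam) ih hn.symm
  have hbound (n : ℕ) : (n + 1 : ℝ) * ‖lam‖ ≤ 2 * ‖a‖ * ‖b‖ := by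
    refine le_of_mul_le_mul_right ?_ (norm_pos_iff.mpr (hne n))
    calc (n + 1 : ℝ) * ‖lam‖ * ‖a ^ n‖ = ‖a ^ (n + 1) * b - b * a ^ (n + 1)‖ := by
          rw [key n, norm_smul, norm_mul, Complex.norm_natCast]
          push_cast
          rfl
      _ ≤ ‖a ^ (n + 1)‖ * ‖b‖ + ‖b‖ * ‖a ^ (n + 1)‖ :=
          (norm_sub_le _ _).trans (add_le_add (norm_mul_le _ _) (norm_mul_le _ _))
      _ = 2 * ‖a * a ^ n‖ * ‖b‖ := by rw [pow_succ']; ring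
      _ ≤ 2 * (‖a‖ * ‖a ^ n‖) * ‖b‖ := by gcongr; exact norm_mul_le _ _
      _ = 2 * ‖a‖ * ‖b‖ * ‖a ^ n‖ := by ring
  have hpos : 0 < ‖lam‖ := norm_pos_iff.mpr hlam
  obtain ⟨n, hn⟩ := exists_nat_gt (2 * ‖a‖ * ‖b‖ / ‖lam‖)
  rw [div_lt_iff₀ hpos] at hn
  linarith [hbound n]
end

section
/- Suppose A is a unital algebra over ℂ and φ : A → ℂ is a linear functional with φ(1) = 1. Then the following are equivalent: (1) for all a ∈ A, φ(a) = 0 implies φ(a²) = 0; (2) for all a ∈ A, φ(a²) = φ(a)²; (3) for all a, b ∈ A, φ(a) = 0 implies φ(ab) = 0; (4) for all a, b ∈ A, φ(ab) = φ(a)φ(b). -/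
/-- For a linear functional `φ` on a unital complex algebra with `φ(1) = 1`, the
following are equivalent: (1) `φ(a) = 0 → φ(a²) = 0`; (2) `φ(a²) = φ(a)²`;
(3) `φ(a) = 0 → φ(ab) = 0`; (4) `φ(ab) = φ(a)φ(b)`. -/
theorem stmt_14 {A : Type*} [Ring A] [Algebra ℂ A] (φ : A →ₗ[ℂ] ℂ) (hφ : φ 1 = 1) :
    List.TFAE [
      ∀ a : A, φ a = 0 → φ (a * a) = 0,
      ∀ a : A, φ (a * a) = φ a * φ a,
      ∀ a b : A, φ a = 0 → φ (a * b) = 0,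
      ∀ a b : A, φ (a * b) = φ a * φ b] := by
  tfae_have 1 → 2 := by
    intro h a
    have h₁ := h (a - φ a • (1 : A)) (by simp [hφ])
    simp only [sub_mul, mul_sub, smul_mul_assoc, mul_smul_comm, one_mul, mul_one, map_sub,
      map_smul, hφ, smul_eq_mul] at h₁
    linear_combination h₁
  tfae_have 2 → 3 := by
    intro h a b ha
    have anticomm : ∀ c : A, φ (a * c) + φ (c * a) = 0 := by
      intro c
      have hac := h (a + c)
      simp only [add_mul, mul_add, map_add, ha] at hac
      linear_combination hac - h a - h c - φ a * ha
    have hsq : φ (a * b) * φ (a * b) + φ (b * a) * φ (b * a) = 0 := by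
      rw [← h, ← h]
      simpa only [mul_assoc] using anticomm (b * a * b)
    have hzero : φ (a * b) * φ (a * b) = 0 := by
      linear_combination hsq / 2 + (φ (a * b) - φ (b * a)) / 2 * anticomm b
    exact mul_self_eq_zero.mp hzero
  tfae_have 3 → 4 := by
    intro h a b
    have h₁ := h (a - φ a • (1 : A)) b (by simp [hφ])
    simp only [sub_mul, smul_mul_assoc, one_mul, map_sub, map_smul, smul_eq_mul] at h₁
    linear_combination h₁
  tfae_have 4 → 1 := by
    intro h a ha
    simp [h, ha]
  tfae_finish
end

section
/- Suppose A is a unital complex Banach algebra and φ : A → ℂ is a linear functional. Then φ is a character (a nonzero multiplicative linear functional) if and only if φ(1) = 1 and φ(a) ≠ 0 for every invertible element a ∈ A (Gleason–Kahane–Żelazko theorem). -/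
open Polynomial

theorem Multiset.sum_sq_eq_sum_map_sq_add_two_mul_esymm {R : Type*} [CommRing R] (s : Multiset R) :
    s.sum ^ 2 = (s.map (· ^ 2)).sum + 2 * s.esymm 2 := by
  induction s using Multiset.induction_on with
  | empty => simp [Multiset.esymm, Multiset.powersetCard_zero_right]
  | cons x s ih =>
    have h : (x ::ₘ s).esymm 2 = s.esymm 2 + x * s.sum := by
      have hm := Multiset.sum_map_mul_left (s := s) (a := x) (f := id)
      simpa [Multiset.esymm, Multiset.powersetCard_cons, Multiset.powersetCard_one,
        Multiset.map_map] using hm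
    rw [h, Multiset.sum_cons, Multiset.map_cons, Multiset.sum_cons]
    linear_combination ih

theorem Multiset.norm_sum_map_sq_le {s : Multiset ℂ} {r : ℝ} (h : ∀ z ∈ s, ‖z‖ ≤ r) :
    ‖(s.map (· ^ 2)).sum‖ ≤ s.card * r ^ 2 := by
  induction s using Multiset.induction_on with
  | empty => simp
  | cons x s ih =>
    have h1 := ih fun z hz => h z (Multiset.mem_cons_of_mem hz)
    have h2 : ‖x ^ 2‖ ≤ r ^ 2 := by
      rw [norm_pow]
      exact pow_le_pow_left₀ (norm_nonneg x) (h x (Multiset.mem_cons_self x s)) 2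
    rw [Multiset.map_cons, Multiset.sum_cons, Multiset.card_cons]
    push_cast
    linarith [norm_add_le (x ^ 2) (s.map (· ^ 2)).sum]

/-- The polynomial `z ↦ φ ((z + a) ^ n)`. -/
noncomputable def LinearMap.shiftPowPoly {A : Type*} [Ring A] [Algebra ℂ A] (φ : A →ₗ[ℂ] ℂ)
    (a : A) (n : ℕ) : ℂ[X] :=
  ∑ k ∈ Finset.range (n + 1), C (φ (a ^ (n - k)) * n.choose k) * X ^ k

namespace LinearMap

section Ring

variable {A : Type*} [Ring A] [Algebra ℂ A] (φ : A →ₗ[ℂ] ℂ)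

theorem eval_shiftPowPoly (a : A) (n : ℕ) (z : ℂ) :
    (φ.shiftPowPoly a n).eval z = φ ((algebraMap ℂ A z + a) ^ n) := by
  rw [Commute.add_pow (Algebra.commutes z a), map_sum, shiftPowPoly,
    eval_finsetSum]
  refine Finset.sum_congr rfl fun k _ => ?_
  have h : algebraMap ℂ A z ^ k * a ^ (n - k) * (n.choose k : A) =
      (z ^ k * n.choose k) • a ^ (n - k) := by
    rw [Algebra.smul_def, map_mul, map_pow, map_natCast, mul_assoc, mul_assoc,
      (Nat.cast_commute (n.choose k) (a ^ (n - k))).eq]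
  rw [h, map_smul, smul_eq_mul]
  simp
  ring

theorem coeff_shiftPowPoly (a : A) (n k : ℕ) :
    (φ.shiftPowPoly a n).coeff k = φ (a ^ (n - k)) * n.choose k := by
  simp only [shiftPowPoly, finsetSum_coeff, coeff_C_mul_X_pow]
  rw [Finset.sum_ite_eq]
  split_ifs with h
  · rfl
  · rw [Nat.choose_eq_zero_of_lt (by simpa [Nat.lt_succ_iff] using h)]
    simp

variable {φ}

theorem natDegree_shiftPowPoly (h1 : φ 1 = 1) (a : A) (n : ℕ) :
    (φ.shiftPowPoly a n).natDegree = n := by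
  apply natDegree_eq_of_le_of_coeff_ne_zero
  · rw [natDegree_le_iff_coeff_eq_zero]
    intro k hk
    simp [coeff_shiftPowPoly, Nat.choose_eq_zero_of_lt hk]
  · simp [coeff_shiftPowPoly, h1]

theorem monic_shiftPowPoly (h1 : φ 1 = 1) (a : A) (n : ℕ) : (φ.shiftPowPoly a n).Monic := by
  rw [Monic, leadingCoeff, natDegree_shiftPowPoly h1]
  simp [coeff_shiftPowPoly, h1]

/-- A unital Jordan functional is multiplicative. -/
theorem map_mul_of_map_sq (h1 : φ 1 = 1) (hsq : ∀ a, φ (a ^ 2) = φ a ^ 2) (a b : A) :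
    φ (a * b) = φ a * φ b := by
  have jordan : ∀ x y, φ (x * y) + φ (y * x) = 2 * (φ x * φ y) := by
    intro x y
    have h := hsq (x + y)
    have e : (x + y) ^ 2 = x ^ 2 + (x * y + y * x) + y ^ 2 := by noncomm_ring
    rw [e] at h
    simp only [map_add, hsq] at h
    linear_combination h
  have ker : ∀ x y, φ x = 0 → φ (x * y) = 0 := by
    intro x y hx
    have hj := jordan x y
    have hc := jordan x (y * x * y)
    have e : (x * y - y * x) ^ 2 + (x * y + y * x) ^ 2 =
        (2 : ℂ) • (x * (y * x * y) + y * x * y * x) := by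
      rw [two_smul]
      noncomm_ring
    have h := congrArg φ e
    simp only [map_add, map_sub, map_smul, hsq, smul_eq_mul, hc, hj, hx] at h
    have h0 : φ (x * y) - φ (y * x) = 0 := by
      apply pow_eq_zero_iff (two_ne_zero) |>.mp
      linear_combination h
    rw [hx] at hj
    linear_combination hj / 2 + h0 / 2
  have h := ker (a - φ a • 1) b (by simp [h1])
  rw [sub_mul, smul_mul_assoc, one_mul, map_sub, map_smul, smul_eq_mul] at h
  exact sub_eq_zero.mp h

end Ring

variable {A : Type*} [NormedRing A] [NormedAlgebra ℂ A] [CompleteSpace A] [NormOneClass A]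
  {φ : A →ₗ[ℂ] ℂ}

theorem norm_le_of_mem_roots_shiftPowPoly (hu : ∀ a, IsUnit a → φ a ≠ 0) {a : A} {n : ℕ} {z : ℂ}
    (hz : z ∈ (φ.shiftPowPoly a n).roots) : ‖z‖ ≤ ‖a‖ := by
  have h0 := (mem_roots'.mp hz).2
  rw [IsRoot, eval_shiftPowPoly] at h0
  have hs : -z ∈ spectrum ℂ a := by
    rw [spectrum.mem_iff]
    intro h
    refine hu _ (IsUnit.pow n ?_) h0
    convert h.neg using 1
    rw [map_neg]
    abel
  simpa using spectrum.norm_le_norm_of_mem hs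

theorem norm_sq_sub_map_sq_le (h1 : φ 1 = 1) (hu : ∀ a, IsUnit a → φ a ≠ 0) (a : A) (n : ℕ) :
    ‖((n + 2 : ℕ) : ℂ) * (φ a ^ 2 - φ (a ^ 2)) + φ (a ^ 2)‖ ≤ ‖a‖ ^ 2 := by
  set p := φ.shiftPowPoly a (n + 2) with hp
  have hdeg : p.natDegree = n + 2 := natDegree_shiftPowPoly h1 a _
  have hmon : p.leadingCoeff = 1 := monic_shiftPowPoly h1 a _
  have hcard : p.roots.card = p.natDegree :=
    (splits_iff_card_roots.mp (IsAlgClosed.splits p))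
  have c1 := coeff_eq_esymm_roots_of_card hcard (k := n + 1) (by omega)
  have c2 := coeff_eq_esymm_roots_of_card hcard (k := n) (by omega)
  rw [hp, coeff_shiftPowPoly, ← hp, hmon, hdeg, show n + 2 - (n + 1) = 1 by omega,
    Multiset.esymm, Multiset.powersetCard_one] at c1
  rw [hp, coeff_shiftPowPoly, ← hp, hmon, hdeg, show n + 2 - n = 2 by omega,
    Nat.choose_symm_add, Nat.cast_choose_two] at c2
  simp [Multiset.map_map] at c1
  have hN := p.roots.sum_sq_eq_sum_map_sq_add_two_mul_esymm
  have hb := Multiset.norm_sum_map_sq_le (s := p.roots) (r := ‖a‖)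
    fun z hz => norm_le_of_mem_roots_shiftPowPoly hu hz
  have key : (p.roots.map (· ^ 2)).sum =
      ((n + 2 : ℕ) : ℂ) * (((n + 2 : ℕ) : ℂ) * (φ a ^ 2 - φ (a ^ 2)) + φ (a ^ 2)) := by
    push_cast at c2 ⊢
    linear_combination -hN + 2 * c2 + (-p.roots.sum + φ a * (n + 2)) * (-c1)
  rw [key, norm_mul, Complex.norm_natCast, hcard, hdeg] at hb
  exact le_of_mul_le_mul_left hb (by positivity)

theorem map_sq_of_ne_zero_of_isUnit (h1 : φ 1 = 1) (hu : ∀ a, IsUnit a → φ a ≠ 0) (a : A) :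
    φ (a ^ 2) = φ a ^ 2 := by
  by_contra hne
  have hd : 0 < ‖φ a ^ 2 - φ (a ^ 2)‖ := norm_pos_iff.mpr (sub_ne_zero.mpr (Ne.symm hne))
  obtain ⟨n, hn⟩ := exists_nat_gt ((‖a‖ ^ 2 + ‖φ (a ^ 2)‖) / ‖φ a ^ 2 - φ (a ^ 2)‖)
  rw [div_lt_iff₀ hd] at hn
  have h := norm_sq_sub_map_sq_le h1 hu a n
  have h' := norm_sub_le_norm_add (((n + 2 : ℕ) : ℂ) * (φ a ^ 2 - φ (a ^ 2))) (φ (a ^ 2))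
  rw [norm_mul, Complex.norm_natCast] at h'
  push_cast at h h'
  linarith

end LinearMap

/-- Gleason–Kahane–Żelazko theorem: a linear functional `φ` on a unital complex Banach
algebra is a character (a nonzero multiplicative linear functional) if and only if
`φ(1) = 1` and `φ(a) ≠ 0` for every invertible `a`. -/
theorem stmt_15 {A : Type*} [NormedRing A] [NormedAlgebra ℂ A] [CompleteSpace A]
    [NormOneClass A] (φ : A →ₗ[ℂ] ℂ) :
    ((∀ a b : A, φ (a * b) = φ a * φ b) ∧ φ ≠ 0) ↔
      (φ 1 = 1 ∧ ∀ a : A, IsUnit a → φ a ≠ 0) := by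
  constructor
  · rintro ⟨hmul, hne⟩
    have h1 : φ 1 = 1 := by
      obtain ⟨a, ha⟩ := DFunLike.ne_iff.mp hne
      have h := hmul a 1
      rw [mul_one] at h
      exact mul_left_cancel₀ ha (by rw [← h, mul_one])
    refine ⟨h1, ?_⟩
    intro a ha h0
    obtain ⟨b, hb⟩ := ha.exists_right_inv
    have h := hmul a b
    rw [hb, h1, h0, zero_mul] at h
    exact one_ne_zero h
  · rintro ⟨h1, hu⟩
    refine ⟨LinearMap.map_mul_of_map_sq h1 (LinearMap.map_sq_of_ne_zero_of_isUnit h1 hu), ?_⟩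
    rintro rfl
    simp at h1
end
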